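/- Every Σ-preserving k-linear map T : k(Γ;F) → k(Δ;G) extends uniquely to a Σ-preserving k-linear map T' : k(Γ;F^⊥⊥) → k(Δ;G^⊥⊥); that is, since F ⊆ F^⊥⊥ and G ⊆ G^⊥⊥ give inclusions k(Γ;F) ⊆ k(Γ;F^⊥⊥) and k(Δ;G) ⊆ k(Δ;G^⊥⊥), there is exactly one Σ-preserving T' whose restriction to k(Γ;F) equals T. -/

import Mathlib

open Function

structure Borno (Γ : Type) where
  sets : Set (Set Γ)
  finite_mem : ∀ s : Set Γ, s.Finite → s ∈ sets
  subset_mem : ∀ s t : Set Γ, s ⊆ t → t ∈ sets → s ∈ sets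
  union_mem : ∀ s t : Set Γ, s ∈ sets → t ∈ sets → s ∪ t ∈ sets

def Borno.orth {Γ : Type} (F : Borno Γ) : Borno Γ where
  sets := {S | ∀ A ∈ F.sets, (S ∩ A).Finite}
  finite_mem := fun _ hs A _ => hs.inter_of_left A
  subset_mem := fun s t hst ht A hA =>
    (ht A hA).subset (Set.inter_subset_inter hst (subset_refl A))
  union_mem := fun s t hs ht A hA => by
    rw [Set.union_inter_distrib_right]
    exact (hs A hA).union (ht A hA)

def bspace (k : Type) [Field k] {Γ : Type} (F : Borno Γ) : Submodule k (Γ → k) where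
  carrier := {f | Function.support f ∈ F.sets}
  add_mem' := fun {f} {g} hf hg =>
    F.subset_mem _ _ (Function.support_add f g) (F.union_mem _ _ hf hg)
  zero_mem' := F.finite_mem _ (by simp)
  smul_mem' := fun c f hf =>
    F.subset_mem _ _ (Function.support_const_smul_subset c f) hf

def SummableFam {k : Type} [Field k] {Γ : Type} (F : Borno Γ) {ι : Type} (f : ι → Γ → k) : Prop :=
  (⋃ i, Function.support (f i)) ∈ F.sets ∧ ∀ γ : Γ, {i | f i γ ≠ 0}.Finite

noncomputable def famSum {k Γ ι : Type} [Field k] (f : ι → Γ → k) : Γ → k :=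
  fun γ => ∑ᶠ i, f i γ

theorem famSum_mem {k : Type} [Field k] {Γ ι : Type} (F : Borno Γ) (f : ι → Γ → k)
    (hf : SummableFam F f) : famSum f ∈ bspace k F := by
  refine F.subset_mem _ _ ?_ hf.1
  intro γ hγ
  by_contra hns
  simp only [Set.mem_iUnion, Function.mem_support] at hns
  push_neg at hns
  exact hγ (by simpa [famSum] using finsum_eq_zero_of_forall_eq_zero hns)

noncomputable def sumElem {k : Type} [Field k] {Γ ι : Type} (F : Borno Γ)
    (f : ι → bspace k F) (hf : SummableFam F (fun i => (f i : Γ → k))) : bspace k F :=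
  ⟨famSum (fun i => (f i : Γ → k)), famSum_mem F _ hf⟩

def SigmaPreserving {k : Type} [Field k] {Γ Δ : Type} {F : Borno Γ} {G : Borno Δ}
    (T : bspace k F →ₗ[k] bspace k G) : Prop :=
  ∀ (ι : Type) (f : ι → bspace k F) (hf : SummableFam F (fun i => (f i : Γ → k))),
    ∃ hg : SummableFam G (fun i => (T (f i) : Δ → k)),
      T (sumElem F f hf) = sumElem G (fun i => T (f i)) hg

noncomputable def pairing {k Γ : Type} [Field k] (f g : Γ → k) : k := ∑ᶠ γ, f γ * g γ

noncomputable def indic {k : Type} [Field k] {Γ : Type} (F : Borno Γ) (γ : Γ) : bspace k F :=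
  ⟨Set.indicator {γ} (fun _ => (1 : k)),
    F.subset_mem _ _ Set.support_indicator_subset
      (F.finite_mem _ (Set.finite_singleton γ))⟩

theorem exists_ne_zero_of_finsum_ne_zero {ι M : Type} [AddCommMonoid M] {f : ι → M}
    (h : ∑ᶠ i, f i ≠ 0) : ∃ i, f i ≠ 0 := by
  by_contra! h'
  exact h (finsum_eq_zero_of_forall_eq_zero h')

theorem row_inter_finite {k Γ Δ : Type} [Field k] {F : Borno Γ} {t : Γ → Δ → k}
    (hrow : ∀ δ, {γ | t γ δ ≠ 0} ∈ F.orth.sets) {A : Set Γ} (hA : A ∈ F.sets) (δ : Δ) :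
    {γ | γ ∈ A ∧ t γ δ ≠ 0}.Finite :=
  (hrow δ A hA).subset fun _ h => ⟨h.2, h.1⟩

theorem support_mul_finite {k Γ Δ : Type} [Field k] {F : Borno Γ} {t : Γ → Δ → k}
    (hrow : ∀ δ, {γ | t γ δ ≠ 0} ∈ F.orth.sets) {f : Γ → k} (hf : f ∈ bspace k F) (δ : Δ) :
    (support fun γ => f γ * t γ δ).Finite :=
  (row_inter_finite hrow (A := support f) hf δ).subset fun _ h =>
    ⟨left_ne_zero_of_mul h, right_ne_zero_of_mul h⟩

theorem support_finsum_mul_subset {k Γ Δ : Type} [Field k] (t : Γ → Δ → k) (f : Γ → k) :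
    (support fun δ => ∑ᶠ γ, f γ * t γ δ) ⊆ ⋃ γ ∈ support f, support (t γ) := by
  intro δ hδ
  obtain ⟨γ, hγ⟩ := exists_ne_zero_of_finsum_ne_zero hδ
  exact Set.mem_biUnion (left_ne_zero_of_mul hγ) (right_ne_zero_of_mul hγ)

/-- The linear map with columns `t γ`, when every row is orthogonal to `F` and
the columns indexed by a member of `F` have their supports jointly in `G`. -/
noncomputable def matrixMap {k Γ Δ : Type} [Field k] {F : Borno Γ} {G : Borno Δ} (t : Γ → Δ → k)
    (hrow : ∀ δ, {γ | t γ δ ≠ 0} ∈ F.orth.sets)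
    (hcol : ∀ A ∈ F.sets, (⋃ γ ∈ A, support (t γ)) ∈ G.sets) :
    bspace k F →ₗ[k] bspace k G where
  toFun f := ⟨fun δ => ∑ᶠ γ, (f : Γ → k) γ * t γ δ,
    G.subset_mem _ _ (support_finsum_mul_subset t f) (hcol _ f.2)⟩
  map_add' f g := by
    ext δ
    simp only [Submodule.coe_add, Pi.add_apply, add_mul]
    exact finsum_add_distrib (support_mul_finite hrow f.2 δ) (support_mul_finite hrow g.2 δ)
  map_smul' c f := by
    ext δ
    simp only [Submodule.coe_smul, Pi.smul_apply, smul_eq_mul, mul_assoc, RingHom.id_apply]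
    exact (mul_finsum _ c).symm

theorem matrixMap_sigmaPreserving {k Γ Δ : Type} [Field k] {F : Borno Γ} {G : Borno Δ}
    (t : Γ → Δ → k) (hrow : ∀ δ, {γ | t γ δ ≠ 0} ∈ F.orth.sets)
    (hcol : ∀ A ∈ F.sets, (⋃ γ ∈ A, support (t γ)) ∈ G.sets) :
    SigmaPreserving (matrixMap t hrow hcol) := by
  intro ι f hf
  have key : ∀ δ, ∃ S : Finset Γ, ∀ γ, γ ∉ S → t γ δ = 0 ∨ ∀ i, (f i : Γ → k) γ = 0 := by
    intro δ
    refine ⟨(row_inter_finite hrow hf.1 δ).toFinset, fun γ hγ => ?_⟩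
    by_contra! h
    obtain ⟨i, hi⟩ := h.2
    exact hγ ((Set.Finite.mem_toFinset _).2 ⟨Set.mem_iUnion.2 ⟨i, hi⟩, h.1⟩)
  refine ⟨⟨G.subset_mem _ _ (Set.iUnion_subset fun i => ?_) (hcol _ hf.1), fun δ => ?_⟩, ?_⟩
  · exact (support_finsum_mul_subset t (f i)).trans
      (Set.biUnion_subset_biUnion_left (Set.subset_iUnion (fun i => support (f i : Γ → k)) i))
  · obtain ⟨S, hS⟩ := key δ
    refine (S.finite_toSet.biUnion fun γ _ => hf.2 γ).subset fun i hi => ?_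
    obtain ⟨γ, hγ⟩ := exists_ne_zero_of_finsum_ne_zero hi
    have hγS : γ ∈ S := by
      by_contra h
      rcases hS γ h with h | h
      · exact hγ (by simp [h])
      · exact hγ (by simp [h i])
    exact Set.mem_biUnion (Finset.mem_coe.2 hγS) (left_ne_zero_of_mul hγ)
  · ext δ
    obtain ⟨S, hS⟩ := key δ
    have hrestrict : ∀ g : Γ → k, (∀ γ, (∀ i, (f i : Γ → k) γ = 0) → g γ = 0) →
        ∑ᶠ γ, g γ * t γ δ = ∑ γ ∈ S, g γ * t γ δ := by
      intro g hg
      refine finsum_eq_sum_of_support_subset _ fun γ hγ => ?_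
      by_contra h
      rcases hS γ h with h | h
      · exact hγ (by simp [h])
      · exact hγ (by simp [hg γ h])
    change ∑ᶠ γ, (∑ᶠ i, (f i : Γ → k) γ) * t γ δ = ∑ᶠ i, ∑ᶠ γ, (f i : Γ → k) γ * t γ δ
    rw [hrestrict _ fun γ h => by simp [h],
      finsum_congr fun i => hrestrict (f i) fun γ h => h i,
      finsum_sum_comm _ _ fun γ _ => (hf.2 γ).subset fun i hi => left_ne_zero_of_mul hi]
    exact Finset.sum_congr rfl fun γ _ => finsum_mul _ _

theorem indic_apply_self {k Γ : Type} [Field k] (F : Borno Γ) (γ : Γ) :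
    (indic (k := k) F γ : Γ → k) γ = 1 := by
  simp [indic]

theorem indic_apply_of_ne {k Γ : Type} [Field k] (F : Borno Γ) {γ γ' : Γ} (h : γ' ≠ γ) :
    (indic (k := k) F γ : Γ → k) γ' = 0 := by
  simp [indic, h]

theorem summableFam_smul_indic {k Γ : Type} [Field k] {F : Borno Γ} (f : bspace k F) :
    SummableFam F fun γ => ((f : Γ → k) γ • indic F γ : bspace k F).1 := by
  have h : ∀ γ γ', ((f : Γ → k) γ • indic F γ : bspace k F).1 γ' ≠ 0 →
      γ = γ' ∧ (f : Γ → k) γ ≠ 0 := by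
    intro γ γ' h
    have h' : (f : Γ → k) γ * (indic (k := k) F γ : Γ → k) γ' ≠ 0 := h
    refine ⟨?_, left_ne_zero_of_mul h'⟩
    by_contra hne
    exact right_ne_zero_of_mul h' (indic_apply_of_ne F (Ne.symm hne))
  refine ⟨F.subset_mem _ _ (Set.iUnion_subset fun γ γ' hγ => ?_) f.2, fun γ' => ?_⟩
  · obtain ⟨rfl, h0⟩ := h γ γ' hγ
    exact h0
  · exact (Set.finite_singleton γ').subset fun γ hγ => (h γ γ' hγ).1

theorem sumElem_smul_indic {k Γ : Type} [Field k] {F : Borno Γ} (f : bspace k F) :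
    sumElem F (fun γ => (f : Γ → k) γ • indic F γ) (summableFam_smul_indic f) = f := by
  ext γ'
  change ∑ᶠ γ, (f : Γ → k) γ * (indic (k := k) F γ : Γ → k) γ' = (f : Γ → k) γ'
  rw [finsum_eq_single _ γ' fun γ hγ => by rw [indic_apply_of_ne F hγ.symm, mul_zero],
    indic_apply_self, mul_one]

namespace SigmaPreserving

variable {k Γ Δ : Type} [Field k] {F : Borno Γ} {G : Borno Δ} {T : bspace k F →ₗ[k] bspace k G}

theorem apply_eq_finsum (hT : SigmaPreserving T) (f : bspace k F) (δ : Δ) :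
    (T f : Δ → k) δ = ∑ᶠ γ, (f : Γ → k) γ * (T (indic F γ) : Δ → k) δ := by
  obtain ⟨_, h⟩ := hT Γ _ (summableFam_smul_indic f)
  rw [sumElem_smul_indic] at h
  rw [h]
  change ∑ᶠ γ, (T ((f : Γ → k) γ • indic F γ) : Δ → k) δ = _
  simp

theorem summableFam_columns (hT : SigmaPreserving T) {A : Set Γ} (hA : A ∈ F.sets) :
    SummableFam G fun γ : A => (T (indic F (γ : Γ)) : Δ → k) := by
  have h : ∀ (γ : A) (γ' : Γ), (indic (k := k) F (γ : Γ) : Γ → k) γ' ≠ 0 → γ' = γ := by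
    intro γ γ' h
    by_contra hne
    exact h (indic_apply_of_ne F hne)
  refine (hT A (fun γ => indic F (γ : Γ)) ⟨?_, fun γ' => ?_⟩).1
  · refine F.subset_mem _ _ (Set.iUnion_subset fun γ γ' hγ => ?_) hA
    rw [h γ γ' hγ]
    exact γ.2
  · refine Set.Subsingleton.finite fun a ha b hb => Subtype.ext ?_
    rw [← h a γ' ha, ← h b γ' hb]

theorem row_mem_orth (hT : SigmaPreserving T) (δ : Δ) :
    {γ | (T (indic F γ) : Δ → k) δ ≠ 0} ∈ F.orth.sets := by
  intro A hA
  refine (((hT.summableFam_columns hA).2 δ).image Subtype.val).subset ?_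
  rintro γ ⟨hγ, hγA⟩
  exact ⟨⟨γ, hγA⟩, hγ, rfl⟩

theorem columns_mem (hT : SigmaPreserving T) {A : Set Γ} (hA : A ∈ F.sets) :
    (⋃ γ ∈ A, support (T (indic F γ) : Δ → k)) ∈ G.sets := by
  rw [Set.biUnion_eq_iUnion]
  exact (hT.summableFam_columns hA).1

theorem ext_indic (hT : SigmaPreserving T) {S : bspace k F →ₗ[k] bspace k G}
    (hS : SigmaPreserving S) (h : ∀ γ, (T (indic F γ) : Δ → k) = S (indic F γ)) : T = S := by
  ext f δ
  rw [hT.apply_eq_finsum, hS.apply_eq_finsum]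
  simp only [h]

end SigmaPreserving

theorem Borno.subset_orth_orth {Γ : Type} (F : Borno Γ) : F.sets ⊆ F.orth.orth.sets :=
  fun A hA B hB => by
    rw [Set.inter_comm]
    exact hB A hA

theorem rows_mem_orth {k Γ Δ : Type} [Field k] {F : Borno Γ} {G : Borno Δ} {t : Γ → Δ → k}
    (hrow : ∀ δ, {γ | t γ δ ≠ 0} ∈ F.orth.sets)
    (hcol : ∀ A ∈ F.sets, (⋃ γ ∈ A, support (t γ)) ∈ G.sets) {H : Set Δ} (hH : H ∈ G.orth.sets) :
    (⋃ δ ∈ H, {γ | t γ δ ≠ 0}) ∈ F.orth.sets := by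
  intro A hA
  refine ((hH _ (hcol A hA)).biUnion fun δ _ => hrow δ A hA).subset ?_
  rintro γ ⟨hγ, hγA⟩
  obtain ⟨δ, hδ, hne⟩ := Set.mem_iUnion₂.1 hγ
  exact Set.mem_biUnion (⟨hδ, Set.mem_biUnion hγA hne⟩ : δ ∈ H ∩ _) ⟨hne, hγA⟩

theorem columns_mem_orth_orth {k Γ Δ : Type} [Field k] {F : Borno Γ} {G : Borno Δ}
    {t : Γ → Δ → k} (hrow : ∀ δ, {γ | t γ δ ≠ 0} ∈ F.orth.sets)
    (hcol : ∀ A ∈ F.sets, (⋃ γ ∈ A, support (t γ)) ∈ G.sets) {A : Set Γ}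
    (hA : A ∈ F.orth.orth.sets) : (⋃ γ ∈ A, support (t γ)) ∈ G.orth.orth.sets := by
  intro H hH
  have hsupp : ∀ γ, (H ∩ support (t γ)).Finite := fun γ =>
    (hH _ (hcol {γ} (F.finite_mem _ (Set.finite_singleton γ)))).subset
      (Set.inter_subset_inter_right _ (by simp))
  refine ((hA _ (rows_mem_orth hrow hcol hH)).biUnion fun γ _ => hsupp γ).subset ?_
  rintro δ ⟨hδ, hδH⟩
  obtain ⟨γ, hγ, hne⟩ := Set.mem_iUnion₂.1 hδ
  exact Set.mem_biUnion (⟨hγ, Set.mem_biUnion hδH hne⟩ : γ ∈ A ∩ _) ⟨hδH, hne⟩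

/-- every Σ-preserving `T : k(Γ;F) → k(Δ;G)` extends uniquely to a Σ-preserving
`T' : k(Γ;F^⊥⊥) → k(Δ;G^⊥⊥)` along the inclusions `k(Γ;F) ⊆ k(Γ;F^⊥⊥)`,
`k(Δ;G) ⊆ k(Δ;G^⊥⊥)`. -/
theorem stmt8 {k : Type} [Field k] {Γ Δ : Type} (F : Borno Γ) (G : Borno Δ)
    (T : bspace k F →ₗ[k] bspace k G) (hT : SigmaPreserving T) :
    ∃! T' : bspace k F.orth.orth →ₗ[k] bspace k G.orth.orth,
      SigmaPreserving T' ∧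
      ∀ (f : Γ → k) (hf : f ∈ bspace k F) (hf' : f ∈ bspace k F.orth.orth),
        ((T' ⟨f, hf'⟩ : Δ → k)) = ((T ⟨f, hf⟩ : Δ → k)) := by
  have hrow' : ∀ δ, {γ | (T (indic F γ) : Δ → k) δ ≠ 0} ∈ F.orth.orth.orth.sets :=
    fun δ => F.orth.subset_orth_orth (hT.row_mem_orth δ)
  have hcol' : ∀ A ∈ F.orth.orth.sets,
      (⋃ γ ∈ A, support (T (indic F γ) : Δ → k)) ∈ G.orth.orth.sets :=
    fun _ hA => columns_mem_orth_orth hT.row_mem_orth (fun _ h => hT.columns_mem h) hA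
  have hext : ∀ (f : Γ → k) (hf : f ∈ bspace k F) (hf' : f ∈ bspace k F.orth.orth),
      (matrixMap _ hrow' hcol' ⟨f, hf'⟩ : Δ → k) = T ⟨f, hf⟩ :=
    fun f hf _ => funext fun δ => (hT.apply_eq_finsum ⟨f, hf⟩ δ).symm
  have hS := matrixMap_sigmaPreserving _ hrow' hcol'
  refine ⟨matrixMap _ hrow' hcol', ⟨hS, hext⟩, fun T' ⟨hT', hT'ext⟩ => ?_⟩
  refine hT'.ext_indic hS fun γ => ?_
  exact (hT'ext _ (indic F γ).2 (indic F.orth.orth γ).2).trans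
    (hext _ (indic F γ).2 (indic F.orth.orth γ).2).symm
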